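/- arXiv:1203.4885 — 2 statements merged into one kernel-verified Lean document; each statement's English description precedes it below -/
import Mathlib

section
/- Let I be a finite type and let A₀, A₁, R be positive semidefinite matrices in Matrix I I ℂ such that B₀ := A₀ − R and B₁ := A₁ + R are also positive semidefinite. Let S be a monotone subset of (Fin n → Fin 2), i.e. if s ∈ S and s j ≤ t j for all j then t ∈ S. Then ∑_{s ∈ S} ⨂ⱼ B_{s j} ≥ ∑_{s ∈ S} ⨂ⱼ A_{s j} in the Loewner order. -/
open Matrix Finset ComplexOrder

/-- The `n`-fold Kronecker product of matrices `M 0, …, M (n-1)`, indexed by `Fin n → I`. -/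
noncomputable def nKron {n : ℕ} {I : Type*} [Fintype I] (M : Fin n → Matrix I I ℂ) :
    Matrix (Fin n → I) (Fin n → I) ℂ :=
  fun f g => ∏ j, M j (f j) (g j)

open scoped Kronecker

theorem nKron_zero {I : Type*} [Fintype I] [DecidableEq I] (M : Fin 0 → Matrix I I ℂ) :
    nKron M = 1 := by
  ext f g
  simp [nKron, Matrix.one_apply, Subsingleton.elim f g]

theorem nKron_succ {I : Type*} [Fintype I] {n : ℕ} (M : Fin (n + 1) → Matrix I I ℂ) :
    nKron M = (M 0 ⊗ₖ nKron fun j => M j.succ).submatrix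
      (fun f => (f 0, fun j => f j.succ)) (fun f => (f 0, fun j => f j.succ)) := by
  ext f g
  simp [nKron, Fin.prod_univ_succ]

theorem nKron_posSemidef {I : Type*} [Fintype I] {n : ℕ} {M : Fin n → Matrix I I ℂ}
    (hM : ∀ j, (M j).PosSemidef) : (nKron M).PosSemidef := by
  classical
  induction n with
  | zero =>
    rw [nKron_zero]
    exact PosSemidef.one
  | succ n ih =>
    rw [nKron_succ]
    exact ((hM 0).kronecker (ih fun j => hM j.succ)).submatrix _

/-- Summing over a finite set of binary words, according to their first letter. -/
theorem sum_eq_sum_cons_zero_add_sum_cons_one {M : Type*} [AddCommMonoid M] {n : ℕ}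
    (S : Finset (Fin (n + 1) → Fin 2)) (f : (Fin (n + 1) → Fin 2) → M) :
    ∑ s ∈ S, f s
      = ∑ s : Fin n → Fin 2 with Fin.cons 0 s ∈ S, f (Fin.cons 0 s)
        + ∑ s : Fin n → Fin 2 with Fin.cons 1 s ∈ S, f (Fin.cons 1 s) := by
  classical
  rw [Finset.sum_filter, Finset.sum_filter, ← Fintype.sum_ite_mem S f,
    ← (Fin.consEquiv fun _ : Fin (n + 1) => Fin 2).sum_comp, Fintype.sum_prod_type,
    Fin.sum_univ_two]
  rfl

theorem sum_nKron_succ {I : Type*} [Fintype I] (M : Fin 2 → Matrix I I ℂ) {n : ℕ}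
    (S : Finset (Fin (n + 1) → Fin 2)) :
    ∑ s ∈ S, nKron (fun j => M (s j))
      = (M 0 ⊗ₖ (∑ s : Fin n → Fin 2 with Fin.cons 0 s ∈ S, nKron (fun j => M (s j)))
        + M 1 ⊗ₖ (∑ s : Fin n → Fin 2 with Fin.cons 1 s ∈ S, nKron (fun j => M (s j)))
        ).submatrix (fun f : Fin (n + 1) → I => (f 0, fun j => f j.succ))
          (fun f => (f 0, fun j => f j.succ)) := by
  rw [sum_eq_sum_cons_zero_add_sum_cons_one]
  ext f g
  simp [nKron, Fin.prod_univ_succ, Matrix.sum_apply, Finset.mul_sum]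

theorem sum_nKron_sub_posSemidef {I : Type*} [Fintype I] {A B : Fin 2 → Matrix I I ℂ}
    (hA : ∀ i, (A i).PosSemidef) (hB : ∀ i, (B i).PosSemidef)
    (hAB : B 0 + B 1 = A 0 + A 1) (hR : (B 1 - A 1).PosSemidef)
    {n : ℕ} (S : Finset (Fin n → Fin 2))
    (hS : ∀ s ∈ S, ∀ t : Fin n → Fin 2, (∀ j, s j ≤ t j) → t ∈ S) :
    ((∑ s ∈ S, nKron (fun j => B (s j))) - ∑ s ∈ S, nKron (fun j => A (s j))).PosSemidef := by
  classical
  induction n with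
  | zero =>
    simp only [nKron_zero, sub_self]
    exact PosSemidef.zero
  | succ n ih =>
    have key (i : Fin 2) := ih {s | Fin.cons i s ∈ S} fun s hs t hst => by
      simp only [mem_filter, mem_univ, true_and] at hs ⊢
      exact hS _ hs _ (Fin.cases (by simp) (by simpa using hst))
    have hsub : (univ.filter fun s : Fin n → Fin 2 => Fin.cons 0 s ∈ S) ⊆
        univ.filter fun s => Fin.cons 1 s ∈ S := by
      intro s hs
      simp only [mem_filter, mem_univ, true_and] at hs ⊢
      exact hS _ hs _ fun j => by cases j using Fin.cases <;> simp
    have hdiff := posSemidef_sum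
      ((univ.filter fun s : Fin n → Fin 2 => Fin.cons 1 s ∈ S) \
        univ.filter fun s => Fin.cons 0 s ∈ S)
      (fun s _ => nKron_posSemidef fun j => hA (s j))
    rw [Finset.sum_sdiff_eq_sub hsub] at hdiff
    rw [sum_nKron_succ, sum_nKron_succ]
    have h0 : B 0 = A 0 + A 1 - B 1 := eq_sub_of_add_eq hAB
    refine Eq.subst (motive := PosSemidef) ?_
      (((((hB 0).kronecker (key 0)).add ((hB 1).kronecker (key 1))).add
        (hR.kronecker hdiff)).submatrix fun f : Fin (n + 1) → I => (f 0, fun j => f j.succ))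
    ext f g
    simp only [h0, submatrix_apply, Matrix.add_apply, Matrix.sub_apply, kronecker_apply]
    ring

theorem stmt1 {I : Type*} [Fintype I] [DecidableEq I]
    (A₀ A₁ R : Matrix I I ℂ)
    (hA₀ : A₀.PosSemidef) (hA₁ : A₁.PosSemidef) (hR : R.PosSemidef)
    (hB₀ : (A₀ - R).PosSemidef) (hB₁ : (A₁ + R).PosSemidef)
    (n : ℕ) (S : Finset (Fin n → Fin 2))
    (hS : ∀ s ∈ S, ∀ t : Fin n → Fin 2, (∀ j, s j ≤ t j) → t ∈ S) :
    ((∑ s ∈ S, nKron (fun j => if s j = 1 then A₁ + R else A₀ - R))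
      - (∑ s ∈ S, nKron (fun j => if s j = 1 then A₁ else A₀))).PosSemidef := by
  refine sum_nKron_sub_posSemidef (A := fun i => if i = 1 then A₁ else A₀)
    (B := fun i => if i = 1 then A₁ + R else A₀ - R) ?_ ?_ ?_ ?_ S hS
  · intro i
    split_ifs <;> assumption
  · intro i
    split_ifs <;> assumption
  · simp only [zero_ne_one, if_true, if_false]
    abel
  · simpa using hR
end

section
/- Fix finite nonempty types α and β, positive semidefinite matrices P₀, P₁ : Matrix (α × β) (α × β) ℂ, and a positive semidefinite ρ : Matrix β β ℂ with trace 1 such that P₀ + P₁ = I_α ⊗ ρ. Let X be a single-repetition strategy and let p := re (Tr (P₁ * X)). Then the matrix X^{⊗n}, defined on index type (Fin n → α × β) by X^{⊗n} f g = ∏ⱼ X (f j) (g j), is an n-repetition strategy, and for every 0 ≤ k ≤ n: re (∑_{s ∈ Σ^n_{≥k}} Tr ((⨂ⱼ P_{s j}) * X^{⊗n})) = ∑_{t = k}^{n} (n.choose t) * p^t * (1 − p)^(n−t). That is, playing a single-repetition strategy independently in each of n parallel repetitions wins at least k of them with probability exactly the binomial tail. -/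
open Matrix Finset ComplexOrder

/-- The set `Σ^n_{≥k}` of binary strings of length `n` with at least `k` ones. -/
def SigmaGe (n k : ℕ) : Finset (Fin n → Fin 2) :=
  Finset.univ.filter fun s => k ≤ (Finset.univ.filter fun j => s j = 1).card

/-- A single-repetition strategy for Bob. -/
def IsStrategy {α β : Type*} [Fintype α] [Fintype β] [DecidableEq β]
    (X : Matrix (α × β) (α × β) ℂ) : Prop :=
  X.PosSemidef ∧
    ∀ b b' : β, ∑ a : α, X (a, b) (a, b') = if b = b' then 1 else 0

/-- An `n`-repetition strategy for Bob. -/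
def IsParStrategy {α β : Type*} [Fintype α] [Fintype β] [DecidableEq β] (n : ℕ)
    (X : Matrix (Fin n → α × β) (Fin n → α × β) ℂ) : Prop :=
  X.PosSemidef ∧
    ∀ b b' : Fin n → β,
      ∑ a : Fin n → α, X (fun j => (a j, b j)) (fun j => (a j, b' j)) =
        if b = b' then 1 else 0

open scoped MatrixOrder in
theorem exists_eq_conjTranspose_mul_self {I : Type*} [Fintype I] {A : Matrix I I ℂ}
    (hA : A.PosSemidef) : ∃ B : Matrix I I ℂ, A = Bᴴ * B := by
  classical
  exact CStarAlgebra.nonneg_iff_eq_star_mul_self.mp hA.nonneg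

theorem nKron_mul_nKron {n : ℕ} {I : Type*} [Fintype I] (A B : Fin n → Matrix I I ℂ) :
    nKron A * nKron B = nKron fun j => A j * B j := by
  ext f g
  simp only [nKron, Matrix.mul_apply, Fintype.prod_sum, Finset.prod_mul_distrib]

theorem conjTranspose_nKron {n : ℕ} {I : Type*} [Fintype I] (A : Fin n → Matrix I I ℂ) :
    (nKron A)ᴴ = nKron fun j => (A j)ᴴ := by
  ext f g
  simp [nKron, Matrix.conjTranspose_apply]

theorem trace_nKron {n : ℕ} {I : Type*} [Fintype I] (A : Fin n → Matrix I I ℂ) :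
    (nKron A).trace = ∏ j, (A j).trace := by
  simp only [nKron, Matrix.trace, Matrix.diag_apply, Fintype.prod_sum]

theorem posSemidef_nKron {n : ℕ} {I : Type*} [Fintype I] {A : Fin n → Matrix I I ℂ}
    (hA : ∀ j, (A j).PosSemidef) : (nKron A).PosSemidef := by
  choose B hB using fun j => exists_eq_conjTranspose_mul_self (hA j)
  rw [funext hB, ← nKron_mul_nKron, ← conjTranspose_nKron]
  exact Matrix.posSemidef_conjTranspose_mul_self _

theorem trace_mul_nonneg_of_posSemidef {I : Type*} [Fintype I] {A B : Matrix I I ℂ}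
    (hA : A.PosSemidef) (hB : B.PosSemidef) : 0 ≤ (A * B).trace := by
  obtain ⟨C, rfl⟩ := exists_eq_conjTranspose_mul_self hB
  rw [← Matrix.mul_assoc, Matrix.trace_mul_comm, ← Matrix.mul_assoc]
  exact (hA.mul_mul_conjTranspose_same C).trace_nonneg

/-- A tensor power of a single-repetition strategy is an `n`-repetition strategy. -/
theorem IsStrategy.isParStrategy_nKron {α β : Type*} [Fintype α] [Fintype β] [DecidableEq β]
    {X : Matrix (α × β) (α × β) ℂ} (hX : IsStrategy X) (n : ℕ) :
    IsParStrategy n (nKron fun _ : Fin n => X) := by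
  refine ⟨posSemidef_nKron fun _ => hX.1, fun b b' => ?_⟩
  simp only [nKron]
  rw [← Fintype.prod_sum fun j a => X (a, b j) (a, b' j)]
  simp only [hX.2, funext_iff, Finset.prod_ite_zero, Finset.prod_const_one, Finset.mem_univ,
    true_imp_iff]

/-- Against `I ⊗ ρ`, every strategy has total weight `tr ρ`. -/
theorem IsStrategy.trace_one_kron_mul {α β : Type*} [Fintype α] [Fintype β] [DecidableEq α]
    [DecidableEq β] {X : Matrix (α × β) (α × β) ℂ} (hX : IsStrategy X) (ρ : Matrix β β ℂ) :
    ((Matrix.of fun p q : α × β => (if p.1 = q.1 then (1 : ℂ) else 0) * ρ p.2 q.2) * X).trace =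
      ρ.trace := by
  simp only [Matrix.trace, Matrix.diag_apply, Matrix.mul_apply, Fintype.sum_prod_type,
    Matrix.of_apply, ite_mul, one_mul, zero_mul]
  calc ∑ a : α, ∑ b, ∑ a', ∑ b', (if a = a' then ρ b b' * X (a', b') (a, b) else 0)
      = ∑ a : α, ∑ b, ∑ b', ρ b b' * X (a, b') (a, b) := by
        refine Finset.sum_congr rfl fun a _ => Finset.sum_congr rfl fun b _ => ?_
        rw [Finset.sum_comm]
        simp
    _ = ∑ b, ∑ b', ρ b b' * ∑ a : α, X (a, b') (a, b) := by
        rw [Finset.sum_comm]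
        refine Finset.sum_congr rfl fun b _ => ?_
        rw [Finset.sum_comm]
        simp only [Finset.mul_sum]
    _ = ∑ b, ρ b b := by simp [hX.2]

theorem sum_sigmaGe_prod_ite {R : Type*} [CommSemiring R] (x y : R) (n k : ℕ) :
    ∑ s ∈ SigmaGe n k, ∏ j, (if s j = 1 then x else y) =
      ∑ t ∈ Finset.Icc k n, (n.choose t : R) * x ^ t * y ^ (n - t) := by
  have hprod (s : Fin n → Fin 2) : ∏ j, (if s j = 1 then x else y) =
      x ^ #{j | s j = 1} * y ^ (n - #{j | s j = 1}) := by
    rw [Finset.prod_ite, Finset.prod_const, Finset.prod_const, ← Finset.compl_filter,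
      Finset.card_compl, Fintype.card_fin]
  have hpow := Finset.sum_powerset_apply_card
    (fun t => if k ≤ t then x ^ t * y ^ (n - t) else 0) (x := (Finset.univ : Finset (Fin n)))
  rw [Finset.powerset_univ, Finset.card_univ, Fintype.card_fin] at hpow
  calc ∑ s ∈ SigmaGe n k, ∏ j, (if s j = 1 then x else y)
      = ∑ s : Fin n → Fin 2,
          if k ≤ #{j | s j = 1} then x ^ #{j | s j = 1} * y ^ (n - #{j | s j = 1}) else 0 := by
        rw [SigmaGe, Finset.sum_filter]
        simp only [hprod]
    _ = ∑ S : Finset (Fin n), if k ≤ #S then x ^ #S * y ^ (n - #S) else 0 := by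
        refine Finset.sum_nbij' (fun s => Finset.univ.filter fun j => s j = 1)
          (fun S j => if j ∈ S then 1 else 0) (by simp) (by simp)
          (fun s _ => ?_) (fun S _ => ?_) (fun _ _ => rfl)
        · funext j
          have : ∀ i : Fin 2, (if i = 1 then (1 : Fin 2) else 0) = i := by decide
          simpa using this (s j)
        · ext j
          simp
    _ = _ := by
        rw [hpow]
        simp only [smul_ite, smul_zero, nsmul_eq_mul, ← mul_assoc]
        rw [← Finset.sum_filter]
        refine Finset.sum_congr ?_ fun _ _ => rfl
        ext t
        simp [and_comm]

theorem stmt13 {α β : Type*} [Fintype α] [Fintype β] [DecidableEq α] [DecidableEq β]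
    [Nonempty α] [Nonempty β]
    (P₀ P₁ : Matrix (α × β) (α × β) ℂ) (hP₀ : P₀.PosSemidef) (hP₁ : P₁.PosSemidef)
    (ρ : Matrix β β ℂ) (hρ : ρ.PosSemidef) (hρtr : ρ.trace = 1)
    (hPsum : P₀ + P₁ =
      Matrix.of fun p q : α × β => (if p.1 = q.1 then (1 : ℂ) else 0) * ρ p.2 q.2)
    (X : Matrix (α × β) (α × β) ℂ) (hX : IsStrategy X)
    (p : ℝ) (hp : p = ((P₁ * X).trace).re)
    (n : ℕ) (k : ℕ) (hk : k ≤ n) :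
    IsParStrategy n (nKron (fun _ : Fin n => X)) ∧
      (∑ s ∈ SigmaGe n k,
          ((nKron (fun j => if s j = 1 then P₁ else P₀)) * nKron (fun _ : Fin n => X)).trace).re =
        ∑ t ∈ Finset.Icc k n, (n.choose t : ℝ) * p ^ t * (1 - p) ^ (n - t) := by
  refine ⟨hX.isParStrategy_nKron n, ?_⟩
  have h₁ : (P₁ * X).trace = p :=
    hp ▸ Complex.eq_re_of_ofReal_le (r := 0)
      (by simpa using trace_mul_nonneg_of_posSemidef hP₁ hX.1)
  have hsum : (P₀ * X).trace + (P₁ * X).trace = 1 := by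
    rw [← Matrix.trace_add, ← Matrix.add_mul, hPsum, hX.trace_one_kron_mul, hρtr]
  have h₀ : (P₀ * X).trace = (1 - p : ℝ) := by
    rw [eq_sub_of_add_eq hsum, h₁]
    push_cast
    rfl
  rw [← sum_sigmaGe_prod_ite, ← Complex.ofReal_re (∑ s ∈ _, _)]
  congr 1
  push_cast
  refine Finset.sum_congr rfl fun s _ => ?_
  rw [nKron_mul_nKron, trace_nKron]
  refine Finset.prod_congr rfl fun j _ => ?_
  split_ifs
  · exact h₁
  · simpa using h₀
end
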